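/- arXiv:2603.12841 — 11 statements merged into one kernel-verified Lean document; each statement's English description precedes it below -/
import Mathlib

section
/- Let M : ℝⁿ → Matrix (Fin n) (Fin n) ℝ be differentiable with M(q) symmetric for every q. Define the Christoffel symbols of the first kind c_{ijk}(q) := (1/2)(∂M_{kj}/∂q_i + ∂M_{ki}/∂q_j − ∂M_{ij}/∂q_k) and the Coriolis matrix C(q,v) with entries C_{kj}(q,v) := Σᵢ c_{ijk}(q) vᵢ. Then for every q, v ∈ ℝⁿ, the matrix with (k,j)-entry Σᵢ (∂M_{kj}/∂q_i)(q) vᵢ − 2 C_{kj}(q,v) is skew-symmetric; equivalently, along any differentiable curve q(t) with q̇(t) = v(t), the matrix (d/dt)M(q(t)) − 2C(q(t),v(t)) is skew-symmetric. -/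
open Matrix

noncomputable section

/-- Entrywise partial derivative `∂M_{kj}/∂q_i` of a matrix-valued map. -/
def dMdq {n : ℕ} (M : (Fin n → ℝ) → Matrix (Fin n) (Fin n) ℝ)
    (q : Fin n → ℝ) (i k j : Fin n) : ℝ :=
  fderiv ℝ (fun q' => M q' k j) q (Pi.single i 1)

/-- Christoffel symbols of the first kind:
`c_{ijk}(q) = (1/2)(∂M_{kj}/∂q_i + ∂M_{ki}/∂q_j − ∂M_{ij}/∂q_k)`. -/
def christoffel {n : ℕ} (M : (Fin n → ℝ) → Matrix (Fin n) (Fin n) ℝ)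
    (q : Fin n → ℝ) (i j k : Fin n) : ℝ :=
  (1 / 2) * (dMdq M q i k j + dMdq M q j k i - dMdq M q k i j)

/-- Coriolis matrix: `C_{kj}(q,v) = Σᵢ c_{ijk}(q) vᵢ`. -/
def coriolis {n : ℕ} (M : (Fin n → ℝ) → Matrix (Fin n) (Fin n) ℝ)
    (q v : Fin n → ℝ) : Matrix (Fin n) (Fin n) ℝ :=
  Matrix.of fun k j => ∑ i, christoffel M q i j k * v i

/-- The matrix `Ṁ − 2C` with `(k,j)`-entry `Σᵢ (∂M_{kj}/∂q_i) vᵢ − 2C_{kj}(q,v)`. -/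
def mDotMinusTwoC {n : ℕ} (M : (Fin n → ℝ) → Matrix (Fin n) (Fin n) ℝ)
    (q v : Fin n → ℝ) : Matrix (Fin n) (Fin n) ℝ :=
  Matrix.of fun k j => (∑ i, dMdq M q i k j * v i) - 2 * coriolis M q v k j

theorem dMdq_swap {n : ℕ} {M : (Fin n → ℝ) → Matrix (Fin n) (Fin n) ℝ}
    (hsymm : ∀ q, (M q)ᵀ = M q) (q : Fin n → ℝ) (i k j : Fin n) :
    dMdq M q i k j = dMdq M q i j k := by
  have h : (fun q' => M q' k j) = fun q' => M q' j k :=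
    funext fun q' => congrFun₂ (hsymm q') j k
  rw [dMdq, dMdq, h]

theorem mDotMinusTwoC_apply {n : ℕ} (M : (Fin n → ℝ) → Matrix (Fin n) (Fin n) ℝ)
    (q v : Fin n → ℝ) (k j : Fin n) :
    mDotMinusTwoC M q v k j = ∑ i, (dMdq M q k i j - dMdq M q j k i) * v i := by
  simp only [mDotMinusTwoC, coriolis, christoffel, Matrix.of_apply, Finset.mul_sum,
    ← Finset.sum_sub_distrib]
  exact Finset.sum_congr rfl fun i _ => by ring

theorem transpose_mDotMinusTwoC {n : ℕ} {M : (Fin n → ℝ) → Matrix (Fin n) (Fin n) ℝ}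
    (hsymm : ∀ q, (M q)ᵀ = M q) (q v : Fin n → ℝ) :
    (mDotMinusTwoC M q v)ᵀ = -(mDotMinusTwoC M q v) := by
  ext k j
  rw [Matrix.transpose_apply, Matrix.neg_apply, mDotMinusTwoC_apply, mDotMinusTwoC_apply,
    ← Finset.sum_neg_distrib]
  refine Finset.sum_congr rfl fun i _ => ?_
  rw [dMdq_swap hsymm q j i k, dMdq_swap hsymm q k j i]
  ring

/-- Chain rule for the matrix entries along a curve. -/
theorem deriv_entry_comp {n : ℕ} {M : (Fin n → ℝ) → Matrix (Fin n) (Fin n) ℝ}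
    {k j : Fin n} {qc : ℝ → Fin n → ℝ} {t : ℝ}
    (hM : DifferentiableAt ℝ (fun q => M q k j) (qc t)) (hqc : DifferentiableAt ℝ qc t) :
    deriv (fun s => M (qc s) k j) t = ∑ i, dMdq M (qc t) i k j * deriv qc t i := by
  have h := (hM.hasFDerivAt.comp_hasDerivAt t hqc.hasDerivAt).deriv
  rw [Function.comp_def] at h
  rw [h, ← ContinuousLinearMap.coe_coe, LinearMap.pi_apply_eq_sum_univ]
  refine Finset.sum_congr rfl fun i _ => ?_
  have hi : (fun l => if i = l then (1 : ℝ) else 0) = Pi.single i 1 := by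
    ext l
    simp [Pi.single_apply, eq_comm]
  rw [hi, smul_eq_mul, mul_comm, ContinuousLinearMap.coe_coe, dMdq]

/-- Skew-symmetry of `Ṁ − 2C`, both pointwise and along differentiable curves. -/
theorem mDot_sub_two_coriolis_skew {n : ℕ}
    (M : (Fin n → ℝ) → Matrix (Fin n) (Fin n) ℝ)
    (hM : ∀ k j : Fin n, Differentiable ℝ (fun q => M q k j))
    (hsymm : ∀ q, (M q)ᵀ = M q) :
    (∀ q v : Fin n → ℝ, (mDotMinusTwoC M q v)ᵀ = -(mDotMinusTwoC M q v)) ∧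
    (∀ (qc : ℝ → Fin n → ℝ), Differentiable ℝ qc → ∀ t : ℝ,
      ((Matrix.of fun k j => deriv (fun s => M (qc s) k j) t)
          - (2 : ℝ) • coriolis M (qc t) (deriv qc t))ᵀ
        = -((Matrix.of fun k j => deriv (fun s => M (qc s) k j) t)
          - (2 : ℝ) • coriolis M (qc t) (deriv qc t))) := by
  refine ⟨transpose_mDotMinusTwoC hsymm, fun qc hqc t => ?_⟩
  have h : (Matrix.of fun k j => deriv (fun s => M (qc s) k j) t)
      - (2 : ℝ) • coriolis M (qc t) (deriv qc t) = mDotMinusTwoC M (qc t) (deriv qc t) := by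
    ext k j
    simp only [mDotMinusTwoC, Matrix.sub_apply, Matrix.smul_apply, Matrix.of_apply, smul_eq_mul,
      deriv_entry_comp (hM k j (qc t)) (hqc t)]
  rw [h]
  exact transpose_mDotMinusTwoC hsymm _ _

end
end

section
/- Let M : ℝⁿ → Matrix (Fin n) (Fin n) ℝ be continuously differentiable with M(q) symmetric for every q, let V : ℝⁿ → ℝ be continuously differentiable, let g : ℝⁿ → ℝᵐ be continuously differentiable, and define the Coriolis matrix C(q,v) with entries C_{kj}(q,v) := Σᵢ c_{ijk}(q) vᵢ where c_{ijk}(q) := (1/2)(∂M_{kj}/∂q_i + ∂M_{ki}/∂q_j − ∂M_{ij}/∂q_k). Suppose differentiable curves q, v : ℝ → ℝⁿ and functions λ : ℝ → ℝᵐ, u : ℝ → ℝᵖ, B̃ : ℝⁿ×ℝⁿ → Matrix (Fin n) (Fin p) ℝ satisfy q̇ = v, M(q) v̇ = −C(q,v) v − ∇V(q) − (Dg(q))ᵀ λ + B̃(q,v) u, and Dg(q) v = 0 for all t. Then the total energy H(q,v) = (1/2)⟨v, M(q)v⟩ + V(q) satisfies (d/dt) H(q(t),v(t)) = ⟨v(t),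 B̃(q(t),v(t)) u(t)⟩ for all t. -/
open Matrix

noncomputable section

/-- Gradient (as a column vector) of a scalar function on `ℝⁿ`. -/
def grad {n : ℕ} (f : (Fin n → ℝ) → ℝ) (x : Fin n → ℝ) : Fin n → ℝ :=
  fun i => fderiv ℝ f x (Pi.single i 1)

/-- Jacobian matrix of a map `ℝⁿ → ℝᵐ`. -/
def jaco {n m : ℕ} (g : (Fin n → ℝ) → (Fin m → ℝ)) (q : Fin n → ℝ) :
    Matrix (Fin m) (Fin n) ℝ :=
  Matrix.of fun a i => fderiv ℝ g q (Pi.single i 1) a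

theorem apply_eq_dotProduct_single {n : ℕ} (L : (Fin n → ℝ) →L[ℝ] ℝ) (w : Fin n → ℝ) :
    L w = w ⬝ᵥ fun i => L (Pi.single i 1) := by
  have h : ∀ i, Pi.single i (w i) = w i • (Pi.single i 1 : Fin n → ℝ) := fun i => by
    rw [← Pi.single_smul', smul_eq_mul, mul_one]
  conv_lhs => rw [← Finset.univ_sum_single w]
  simp only [h, map_sum, map_smul, smul_eq_mul, dotProduct]

/-- The quadratic form of the Coriolis matrix is half the derivative of the mass matrix. -/
theorem dotProduct_coriolis_mulVec {n : ℕ} (M : (Fin n → ℝ) → Matrix (Fin n) (Fin n) ℝ)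
    (x w : Fin n → ℝ) :
    w ⬝ᵥ (coriolis M x w *ᵥ w) =
      (1 / 2) * ∑ k, ∑ j, w k * (fderiv ℝ (fun y => M y k j) x w * w j) := by
  have h : ∀ k j, fderiv ℝ (fun y => M y k j) x w = ∑ i, w i * dMdq M x i k j :=
    fun k j => apply_eq_dotProduct_single _ w
  set S := ∑ k, ∑ j, ∑ i, w k * w j * w i * dMdq M x i k j with hS
  have hS₁ : ∑ k, ∑ j, ∑ i, w k * w j * w i * dMdq M x j k i = S := by
    rw [hS]
    refine Finset.sum_congr rfl fun k _ => ?_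
    rw [Finset.sum_comm]
    exact Finset.sum_congr rfl fun i _ => Finset.sum_congr rfl fun j _ => by ring
  have hS₂ : ∑ k, ∑ j, ∑ i, w k * w j * w i * dMdq M x k i j = S := by
    rw [hS, Finset.sum_comm]
    conv_lhs => enter [2, j]; rw [Finset.sum_comm]
    rw [Finset.sum_comm]
    exact Finset.sum_congr rfl fun i _ => Finset.sum_congr rfl fun j _ =>
      Finset.sum_congr rfl fun k _ => by ring
  have hL : w ⬝ᵥ (coriolis M x w *ᵥ w) = (1 / 2) * (S +
      ∑ k, ∑ j, ∑ i, w k * w j * w i * dMdq M x j k i -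
      ∑ k, ∑ j, ∑ i, w k * w j * w i * dMdq M x k i j) := by
    simp only [hS, dotProduct, mulVec, coriolis, of_apply, christoffel, Finset.mul_sum,
      Finset.sum_mul, ← Finset.sum_add_distrib, ← Finset.sum_sub_distrib]
    exact Finset.sum_congr rfl fun i _ => Finset.sum_congr rfl fun j _ =>
      Finset.sum_congr rfl fun k _ => by ring
  rw [hL, hS₁, hS₂, add_sub_cancel_right, hS]
  simp only [h, Finset.mul_sum, Finset.sum_mul]
  exact Finset.sum_congr rfl fun i _ => Finset.sum_congr rfl fun j _ =>
    Finset.sum_congr rfl fun k _ => by ring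

theorem hasDerivAt_dotProduct_mulVec {n : ℕ} {A : ℝ → Matrix (Fin n) (Fin n) ℝ}
    {A' : Matrix (Fin n) (Fin n) ℝ} {v : ℝ → Fin n → ℝ} {v' : Fin n → ℝ} {t : ℝ}
    (hA : ∀ k j, HasDerivAt (fun s => A s k j) (A' k j) t) (hv : HasDerivAt v v' t) :
    HasDerivAt (fun s => v s ⬝ᵥ (A s *ᵥ v s))
      (v' ⬝ᵥ (A t *ᵥ v t) + v t ⬝ᵥ (A t *ᵥ v') + v t ⬝ᵥ (A' *ᵥ v t)) t := by
  have hv := hasDerivAt_pi.1 hv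
  have key := HasDerivAt.fun_sum (u := Finset.univ) fun k _ =>
    (hv k).fun_mul (HasDerivAt.fun_sum (u := Finset.univ) fun j _ => (hA k j).fun_mul (hv j))
  refine key.congr_deriv ?_
  simp only [dotProduct, mulVec, Finset.sum_add_distrib, mul_add]
  ring

/-- Power balance for the constrained Euler–Lagrange equations of a multibody
system with configuration-dependent mass matrix. -/
theorem multibody_power_balance {n m p : ℕ}
    (M : (Fin n → ℝ) → Matrix (Fin n) (Fin n) ℝ)
    (hM : ∀ k j : Fin n, ContDiff ℝ 1 (fun q => M q k j))
    (hMs : ∀ q, (M q)ᵀ = M q)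
    (V : (Fin n → ℝ) → ℝ) (hV : ContDiff ℝ 1 V)
    (g : (Fin n → ℝ) → Fin m → ℝ) (hg : ContDiff ℝ 1 g)
    (q v : ℝ → Fin n → ℝ) (hq : Differentiable ℝ q) (hv : Differentiable ℝ v)
    (lam : ℝ → Fin m → ℝ) (u : ℝ → Fin p → ℝ)
    (Bt : (Fin n → ℝ) → (Fin n → ℝ) → Matrix (Fin n) (Fin p) ℝ)
    (h1 : ∀ t, deriv q t = v t)
    (h2 : ∀ t, M (q t) *ᵥ deriv v t =
        -(coriolis M (q t) (v t) *ᵥ v t) - grad V (q t)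
          - (jaco g (q t))ᵀ *ᵥ lam t + Bt (q t) (v t) *ᵥ u t)
    (h3 : ∀ t, jaco g (q t) *ᵥ v t = 0) :
    ∀ t, deriv (fun s => (1 / 2) * (v s ⬝ᵥ (M (q s) *ᵥ v s)) + V (q s)) t
      = v t ⬝ᵥ (Bt (q t) (v t) *ᵥ u t) := by
  intro t
  have hqt : HasDerivAt q (v t) t := h1 t ▸ (hq t).hasDerivAt
  have hA : ∀ k j, HasDerivAt (fun s => M (q s) k j)
      (of (fun k j => fderiv ℝ (fun y => M y k j) (q t) (v t)) k j) t := fun k j =>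
    (((hM k j).differentiable one_ne_zero) (q t)).hasFDerivAt.comp_hasDerivAt t hqt
  have hVt : HasDerivAt (fun s => V (q s)) (fderiv ℝ V (q t) (v t)) t :=
    ((hV.differentiable one_ne_zero) (q t)).hasFDerivAt.comp_hasDerivAt t hqt
  have hE := ((hasDerivAt_dotProduct_mulVec hA (hv t).hasDerivAt).const_mul (1 / 2)).fun_add hVt
  refine hE.deriv.trans ?_
  have hsymm : deriv v t ⬝ᵥ (M (q t) *ᵥ v t) = v t ⬝ᵥ (M (q t) *ᵥ deriv v t) := by
    rw [dotProduct_mulVec, ← mulVec_transpose, hMs, dotProduct_comm]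
  have hconstr : v t ⬝ᵥ ((jaco g (q t))ᵀ *ᵥ lam t) = 0 := by
    rw [mulVec_transpose, dotProduct_comm, ← dotProduct_mulVec, h3, dotProduct_zero]
  have hgrad : fderiv ℝ V (q t) (v t) = v t ⬝ᵥ grad V (q t) :=
    apply_eq_dotProduct_single _ _
  have hcor : v t ⬝ᵥ (of (fun k j => fderiv ℝ (fun y => M y k j) (q t) (v t)) *ᵥ v t) =
      2 * (v t ⬝ᵥ (coriolis M (q t) (v t) *ᵥ v t)) := by
    rw [dotProduct_coriolis_mulVec]
    simp only [dotProduct, mulVec, of_apply, Finset.mul_sum]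
    simp
  rw [hsymm, hcor, hgrad, h2]
  simp only [dotProduct_add, dotProduct_sub, dotProduct_neg, hconstr]
  ring

end
end

section
/- Let A be a symmetric real d×d matrix, b ∈ ℝᵈ, c ∈ ℝ, and H(x) = (1/2)⟨x,Ax⟩ + ⟨b,x⟩ + c. Let E be a constant real d×d matrix, J : ℝᵈ → Matrix (Fin d) (Fin d) ℝ with J(x) skew-symmetric for all x, B : ℝᵈ → Matrix (Fin d) (Fin p) ℝ, and z : ℝᵈ → ℝᵈ with Eᵀ z(x) = Ax + b for all x. Suppose h > 0 and states x⁰, x¹ ∈ ℝᵈ and an input u ∈ ℝᵖ satisfy the implicit midpoint step E(x¹ − x⁰) = h J(x_m) z(x_m) + h B(x_m) u with x_m := (x⁰+x¹)/2, and let y := B(x_m)ᵀ z(x_m). Then the discrete power balance holds: H(x¹) − H(x⁰) = h ⟨y, u⟩. In particular, if u = 0 then H(x¹) = H(x⁰). -/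
open Matrix

noncomputable section

/-- The quadratic form of a real skew-symmetric matrix vanishes. -/
theorem dotProduct_mulVec_self_eq_zero_of_transpose_eq_neg {n : Type*} [Fintype n]
    {S : Matrix n n ℝ} (hS : Sᵀ = -S) (v : n → ℝ) : v ⬝ᵥ (S *ᵥ v) = 0 := by
  have key : v ⬝ᵥ (S *ᵥ v) = -(v ⬝ᵥ (S *ᵥ v)) := by
    conv_lhs => rw [dotProduct_mulVec, ← mulVec_transpose, hS, neg_mulVec, neg_dotProduct,
      dotProduct_comm]
  linarith

/-- The midpoint gradient of a quadratic function is a discrete gradient. -/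
theorem midpoint_gradient_dotProduct_sub {n : Type*} [Fintype n]
    {A : Matrix n n ℝ} (hA : Aᵀ = A) (b x0 x1 : n → ℝ) :
    (A *ᵥ (((1 : ℝ) / 2) • (x0 + x1)) + b) ⬝ᵥ (x1 - x0) =
      ((1 / 2) * (x1 ⬝ᵥ (A *ᵥ x1)) + b ⬝ᵥ x1) - ((1 / 2) * (x0 ⬝ᵥ (A *ᵥ x0)) + b ⬝ᵥ x0) := by
  have hsymm : x0 ⬝ᵥ (A *ᵥ x1) = x1 ⬝ᵥ (A *ᵥ x0) := by
    rw [dotProduct_mulVec, ← mulVec_transpose, hA, dotProduct_comm]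
  rw [dotProduct_comm]
  simp only [mulVec_smul, mulVec_add, dotProduct_add, dotProduct_smul, sub_dotProduct, dotProduct_sub,
    smul_eq_mul, dotProduct_comm _ b, hsymm]
  ring

/-- Discrete power balance for the implicit midpoint discretization of a
port-Hamiltonian descriptor system with at most quadratic Hamiltonian. -/
theorem midpoint_discrete_power_balance {d p : ℕ}
    (A : Matrix (Fin d) (Fin d) ℝ) (hA : Aᵀ = A)
    (b : Fin d → ℝ) (c : ℝ)
    (H : (Fin d → ℝ) → ℝ)
    (hH : H = fun x => (1 / 2) * (x ⬝ᵥ (A *ᵥ x)) + b ⬝ᵥ x + c)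
    (E : Matrix (Fin d) (Fin d) ℝ)
    (J : (Fin d → ℝ) → Matrix (Fin d) (Fin d) ℝ)
    (hJ : ∀ x, (J x)ᵀ = -(J x))
    (B : (Fin d → ℝ) → Matrix (Fin d) (Fin p) ℝ)
    (z : (Fin d → ℝ) → Fin d → ℝ)
    (hz : ∀ x, Eᵀ *ᵥ z x = A *ᵥ x + b)
    (h : ℝ) (hh : 0 < h)
    (x0 x1 : Fin d → ℝ) (u : Fin p → ℝ)
    (xm : Fin d → ℝ) (hxm : xm = ((1 : ℝ) / 2) • (x0 + x1))
    (hstep : E *ᵥ (x1 - x0) = h • (J xm *ᵥ z xm) + h • (B xm *ᵥ u))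
    (y : Fin p → ℝ) (hy : y = (B xm)ᵀ *ᵥ z xm) :
    H x1 - H x0 = h * (y ⬝ᵥ u) ∧ (u = 0 → H x1 = H x0) := by
  have hbalance : H x1 - H x0 = h * (y ⬝ᵥ u) := by
    have hgrad : z xm ⬝ᵥ (E *ᵥ (x1 - x0)) = H x1 - H x0 := by
      rw [dotProduct_mulVec, ← mulVec_transpose, hz, hxm, midpoint_gradient_dotProduct_sub hA, hH]
      ring
    rw [← hgrad, hstep, dotProduct_add, dotProduct_smul, dotProduct_smul,
      dotProduct_mulVec_self_eq_zero_of_transpose_eq_neg (hJ xm), dotProduct_mulVec (z xm) (B xm),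
      ← mulVec_transpose, ← hy, smul_zero, zero_add, smul_eq_mul]
  refine ⟨hbalance, fun hu => ?_⟩
  rw [hu, dotProduct_zero, mul_zero] at hbalance
  exact sub_eq_zero.mp hbalance

end
end

section
/- Let g : ℝⁿ → ℝᵐ have components g_a(q) = (1/2)⟨q, A_a q⟩ + ⟨b_a, q⟩ + c_a with each A_a a symmetric real n×n matrix. Suppose h > 0 and q⁰, q¹, v_m ∈ ℝⁿ satisfy q¹ − q⁰ = h v_m and Dg(q_m) v_m = 0 where q_m := (q⁰+q¹)/2 and Dg is the Jacobian of g. Then g(q¹) = g(q⁰). Consequently, for any sequences (qⁿ), (v_mⁿ) with qⁿ⁺¹ − qⁿ = h v_mⁿ and Dg((qⁿ+qⁿ⁺¹)/2) v_mⁿ = 0 for all n, and with g(q⁰) = 0, one has g(qⁿ) = 0 for all n. -/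
open Matrix

noncomputable section

/-- The Jacobian matrix represents the Fréchet derivative. -/
theorem jaco_mulVec {n m : ℕ} (g : (Fin n → ℝ) → Fin m → ℝ) (q v : Fin n → ℝ) :
    jaco g q *ᵥ v = fderiv ℝ g q v := by
  have hv : v = ∑ i, v i • (Pi.single i 1 : Fin n → ℝ) := by
    simpa using (pi_eq_sum_univ' v)
  ext a
  conv_rhs => rw [hv]
  simp [jaco, mulVec, dotProduct, map_sum, Finset.sum_apply, mul_comm]

/-- Restriction of an at most quadratic function to a line. -/
theorem quadratic_add_smul {n : ℕ} (A : Matrix (Fin n) (Fin n) ℝ) (b : Fin n → ℝ) (c : ℝ)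
    (q v : Fin n → ℝ) (t : ℝ) :
    (1 / 2) * ((q + t • v) ⬝ᵥ (A *ᵥ (q + t • v))) + b ⬝ᵥ (q + t • v) + c =
      ((1 / 2) * (q ⬝ᵥ (A *ᵥ q)) + b ⬝ᵥ q + c) +
        t * ((1 / 2) * (q ⬝ᵥ (A *ᵥ v) + v ⬝ᵥ (A *ᵥ q)) + b ⬝ᵥ v) +
        t ^ 2 * ((1 / 2) * (v ⬝ᵥ (A *ᵥ v))) := by
  simp only [mulVec_add, mulVec_smul, dotProduct_add, add_dotProduct, smul_dotProduct,
    dotProduct_smul, smul_eq_mul]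
  ring

/-- Directional derivative of an at most quadratic map. -/
theorem fderiv_quadratic_apply {n m : ℕ} (A : Fin m → Matrix (Fin n) (Fin n) ℝ)
    (b : Fin m → Fin n → ℝ) (c : Fin m → ℝ) (q v : Fin n → ℝ) (a : Fin m) :
    fderiv ℝ (fun (q : Fin n → ℝ) (a : Fin m) =>
        (1 / 2) * (q ⬝ᵥ (A a *ᵥ q)) + b a ⬝ᵥ q + c a) q v a =
      (1 / 2) * (q ⬝ᵥ (A a *ᵥ v) + v ⬝ᵥ (A a *ᵥ q)) + b a ⬝ᵥ v := by
  have hd : DifferentiableAt ℝ (fun (q : Fin n → ℝ) (a : Fin m) =>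
      (1 / 2) * (q ⬝ᵥ (A a *ᵥ q)) + b a ⬝ᵥ q + c a) q := by
    simp only [mulVec, dotProduct]
    fun_prop
  have h1 := hasDerivAt_pi.1 (hd.hasFDerivAt.hasLineDerivAt v) a
  simp only [quadratic_add_smul] at h1
  refine h1.unique ?_
  have h2 := (((hasDerivAt_id (0 : ℝ)).mul_const
    ((1 / 2) * (q ⬝ᵥ (A a *ᵥ v) + v ⬝ᵥ (A a *ᵥ q)) + b a ⬝ᵥ v)).const_add
      ((1 / 2) * (q ⬝ᵥ (A a *ᵥ q)) + b a ⬝ᵥ q + c a)).add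
    (((hasDerivAt_id (0 : ℝ)).pow 2).mul_const ((1 / 2) * (v ⬝ᵥ (A a *ᵥ v))))
  refine h2.congr_deriv ?_
  simp

/-- Exact conservation of at most quadratic holonomic constraints under the
implicit midpoint discretization: one step, and no drift along a whole
discrete trajectory. -/
theorem midpoint_constraint_conservation {n m : ℕ}
    (A : Fin m → Matrix (Fin n) (Fin n) ℝ) (hA : ∀ a, (A a)ᵀ = A a)
    (b : Fin m → Fin n → ℝ) (c : Fin m → ℝ)
    (g : (Fin n → ℝ) → Fin m → ℝ)
    (hg : g = fun q a => (1 / 2) * (q ⬝ᵥ (A a *ᵥ q)) + b a ⬝ᵥ q + c a)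
    (h : ℝ) (hh : 0 < h) :
    (∀ q0 q1 vm : Fin n → ℝ,
      q1 - q0 = h • vm →
      jaco g (((1 : ℝ) / 2) • (q0 + q1)) *ᵥ vm = 0 →
      g q1 = g q0) ∧
    (∀ (q vm : ℕ → Fin n → ℝ),
      (∀ N, q (N + 1) - q N = h • vm N) →
      (∀ N, jaco g (((1 : ℝ) / 2) • (q N + q (N + 1))) *ᵥ vm N = 0) →
      g (q 0) = 0 → ∀ N, g (q N) = 0) := by
  have step : ∀ q0 q1 vm : Fin n → ℝ, q1 - q0 = h • vm →
      jaco g (((1 : ℝ) / 2) • (q0 + q1)) *ᵥ vm = 0 → g q1 = g q0 := by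
    intro q0 q1 vm hq hJ
    set q := ((1 : ℝ) / 2) • (q0 + q1) with hqm
    have h1 : q1 = q + (h / 2) • vm := by
      ext i
      have := congrFun hq i
      simp [hqm] at this ⊢
      linarith
    have h0 : q0 = q + (-(h / 2)) • vm := by
      ext i
      have := congrFun hq i
      simp [hqm] at this ⊢
      linarith
    clear_value q
    subst h1 h0 hg
    ext a
    rw [jaco_mulVec] at hJ
    have hL := congrFun hJ a
    rw [fderiv_quadratic_apply, Pi.zero_apply] at hL
    simp only [quadratic_add_smul, hL]
    ring
  refine ⟨step, fun q vm hq hJ h0 N => ?_⟩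
  induction N with
  | zero => exact h0
  | succ N ih => exact (step _ _ _ (hq N) (hJ N)).trans ih

end
end

section
/- Let M be a symmetric invertible real n×n matrix, let g : ℝⁿ → ℝᵐ be twice continuously differentiable, and write G(q) := Dg(q) (the m×n Jacobian) and, for g_v(q,v) := G(q)v, write P(q,v) := ∂_q g_v(q,v) (the m×n matrix of partial derivatives of g_v with respect to q). Then for every (q,v), the (2n+2m)×(2n+2m) block matrix with block rows [0, I, 0, M⁻¹G(q)ᵀ], [−I, 0, −G(q)ᵀ, −P(q,v)ᵀ], [0, G(q), 0, G(q)M⁻¹G(q)ᵀ], [−G(q)M⁻¹, P(q,v), −G(q)M⁻¹G(q)ᵀ, J₄₄(q,v)], where J₄₄(q,v) := P(q,v)M⁻¹G(q)ᵀ − G(q)M⁻¹P(q,v)ᵀ, is skew-symmetric. -/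
open Matrix

noncomputable section

/-- Partial derivative with respect to `q` of the velocity-level constraint
function `g_v(q,v) = Dg(q)v`: the `m × n` matrix `∂_q g_v(q,v)`. -/
def Pmat {n m : ℕ} (g : (Fin n → ℝ) → (Fin m → ℝ)) (q v : Fin n → ℝ) :
    Matrix (Fin m) (Fin n) ℝ :=
  Matrix.of fun a i => fderiv ℝ (fun q' => (jaco g q' *ᵥ v) a) q (Pi.single i 1)

/-- Skew-symmetry of the structure matrix of the index-1 GGL
port-Hamiltonian descriptor formulation. -/
theorem ggl_structure_matrix_skew {n m : ℕ}
    (M : Matrix (Fin n) (Fin n) ℝ) (hMs : Mᵀ = M) (hMi : IsUnit M.det)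
    (g : (Fin n → ℝ) → (Fin m → ℝ)) (hg : ContDiff ℝ 2 g)
    (q v : Fin n → ℝ) :
    (Matrix.fromBlocks
      (Matrix.fromBlocks (0 : Matrix (Fin n) (Fin n) ℝ) (1 : Matrix (Fin n) (Fin n) ℝ)
        (-(1 : Matrix (Fin n) (Fin n) ℝ)) (0 : Matrix (Fin n) (Fin n) ℝ))
      (Matrix.fromBlocks (0 : Matrix (Fin n) (Fin m) ℝ) (M⁻¹ * (jaco g q)ᵀ)
        (-(jaco g q)ᵀ) (-(Pmat g q v)ᵀ))
      (Matrix.fromBlocks (0 : Matrix (Fin m) (Fin n) ℝ) (jaco g q)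
        (-(jaco g q * M⁻¹)) (Pmat g q v))
      (Matrix.fromBlocks (0 : Matrix (Fin m) (Fin m) ℝ) (jaco g q * M⁻¹ * (jaco g q)ᵀ)
        (-(jaco g q * M⁻¹ * (jaco g q)ᵀ))
        (Pmat g q v * M⁻¹ * (jaco g q)ᵀ - jaco g q * M⁻¹ * (Pmat g q v)ᵀ)))ᵀ
    =
    -(Matrix.fromBlocks
      (Matrix.fromBlocks (0 : Matrix (Fin n) (Fin n) ℝ) (1 : Matrix (Fin n) (Fin n) ℝ)
        (-(1 : Matrix (Fin n) (Fin n) ℝ)) (0 : Matrix (Fin n) (Fin n) ℝ))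
      (Matrix.fromBlocks (0 : Matrix (Fin n) (Fin m) ℝ) (M⁻¹ * (jaco g q)ᵀ)
        (-(jaco g q)ᵀ) (-(Pmat g q v)ᵀ))
      (Matrix.fromBlocks (0 : Matrix (Fin m) (Fin n) ℝ) (jaco g q)
        (-(jaco g q * M⁻¹)) (Pmat g q v))
      (Matrix.fromBlocks (0 : Matrix (Fin m) (Fin m) ℝ) (jaco g q * M⁻¹ * (jaco g q)ᵀ)
        (-(jaco g q * M⁻¹ * (jaco g q)ᵀ))
        (Pmat g q v * M⁻¹ * (jaco g q)ᵀ - jaco g q * M⁻¹ * (Pmat g q v)ᵀ))) := by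
  have hinv : (M⁻¹)ᵀ = M⁻¹ := by rw [Matrix.transpose_nonsing_inv, hMs]
  simp only [Matrix.fromBlocks_transpose, Matrix.fromBlocks_neg, Matrix.transpose_neg,
    Matrix.transpose_sub, Matrix.transpose_mul, Matrix.transpose_transpose,
    Matrix.transpose_zero, Matrix.transpose_one, hinv, neg_neg, neg_zero, neg_sub,
    Matrix.mul_assoc]

end
end

section
/- Let M be a symmetric invertible real n×n matrix, V : ℝⁿ → ℝ continuously differentiable, g : ℝⁿ → ℝᵐ twice continuously differentiable, G(q) := Dg(q), g_v(q,v) := G(q)v, and P(q,v) := ∂_q g_v(q,v). Suppose differentiable curves q, v : ℝ → ℝⁿ and functions λ, γ : ℝ → ℝᵐ satisfy, for all t: q̇ = v + M⁻¹G(q)ᵀγ; M v̇ = −∇V(q) − G(q)ᵀλ − P(q,v)ᵀγ; 0 = G(q)v + G(q)M⁻¹G(q)ᵀγ; and 0 = −G(q)M⁻¹∇V(q) + P(q,v)v − G(q)M⁻¹G(q)ᵀλ + (P(q,v)M⁻¹G(q)ᵀ − G(q)M⁻¹P(q,v)ᵀ)γ. Then the total energy H(q,v) = (1/2)⟨v,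 Mv⟩ + V(q) is constant in t. -/
open Matrix

noncomputable section

/-- The derivative applied to a vector is the pairing with the gradient. -/
theorem fderiv_apply_eq_grad_dotProduct {n : ℕ} (f : (Fin n → ℝ) → ℝ) (x y : Fin n → ℝ) :
    fderiv ℝ f x y = grad f x ⬝ᵥ y := by
  conv_lhs => rw [pi_eq_sum_univ' y]
  simp [grad, dotProduct, map_sum, mul_comm]

/-- The quadratic form of a symmetric matrix along a differentiable curve. -/
theorem hasDerivAt_half_quadratic {n : ℕ} {M : Matrix (Fin n) (Fin n) ℝ} (hM : Mᵀ = M)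
    {v : ℝ → Fin n → ℝ} {v' : Fin n → ℝ} {t : ℝ} (hv : HasDerivAt v v' t) :
    HasDerivAt (fun s => (1 / 2) * (v s ⬝ᵥ (M *ᵥ v s))) (v t ⬝ᵥ (M *ᵥ v')) t := by
  have hc := hasDerivAt_pi.1 hv
  have hMv : ∀ i, HasDerivAt (fun s => (M *ᵥ v s) i) ((M *ᵥ v') i) t := fun i =>
    HasDerivAt.fun_sum (u := Finset.univ) fun j _ => (hc j).const_mul (M i j)
  have h := (HasDerivAt.fun_sum (u := Finset.univ)
    fun i _ => (hc i).mul (hMv i)).const_mul (1 / 2 : ℝ)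
  have hsymm : v' ⬝ᵥ (M *ᵥ v t) = v t ⬝ᵥ (M *ᵥ v') := by
    rw [dotProduct_mulVec, ← mulVec_transpose, hM, dotProduct_comm]
  refine h.congr_deriv ?_
  rw [Finset.sum_add_distrib]
  change 1 / 2 * (v' ⬝ᵥ (M *ᵥ v t) + v t ⬝ᵥ (M *ᵥ v')) = _
  rw [hsymm]
  ring

/-- The power balance: the constraint equations force the rate of change of energy to vanish. -/
theorem ggl_power_eq_zero {n m : ℕ} {A : Matrix (Fin n) (Fin n) ℝ} (hA : Aᵀ = A)
    (G P : Matrix (Fin m) (Fin n) ℝ) (v d : Fin n → ℝ) (l c : Fin m → ℝ)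
    (h3 : (0 : Fin m → ℝ) = G *ᵥ v + (G * A * Gᵀ) *ᵥ c)
    (h4 : (0 : Fin m → ℝ) = -((G * A) *ᵥ d) + P *ᵥ v - (G * A * Gᵀ) *ᵥ l
      + (P * A * Gᵀ - G * A * Pᵀ) *ᵥ c) :
    v ⬝ᵥ (-d - Gᵀ *ᵥ l - Pᵀ *ᵥ c) + d ⬝ᵥ (v + A *ᵥ (Gᵀ *ᵥ c)) = 0 := by
  have swap : ∀ (B : Matrix (Fin m) (Fin n) ℝ) (x : Fin n → ℝ) (y : Fin m → ℝ),
      x ⬝ᵥ (Bᵀ *ᵥ y) = y ⬝ᵥ (B *ᵥ x) := fun B x y => by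
    rw [mulVec_transpose, dotProduct_comm, dotProduct_mulVec]
  have move : ∀ x : Fin n → ℝ, c ⬝ᵥ (G *ᵥ (A *ᵥ x)) = x ⬝ᵥ (A *ᵥ (Gᵀ *ᵥ c)) := fun x => by
    rw [← swap, dotProduct_comm, dotProduct_mulVec, ← mulVec_transpose, hA, dotProduct_comm]
  have e3 := congrArg (fun x => l ⬝ᵥ x) h3
  have e4 := congrArg (fun x => c ⬝ᵥ x) h4
  simp only [sub_mulVec, ← mulVec_mulVec, dotProduct_add, dotProduct_sub, dotProduct_neg,
    dotProduct_zero, move] at e3 e4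
  simp only [dotProduct_add, dotProduct_sub, dotProduct_neg, swap]
  rw [dotProduct_comm (Gᵀ *ᵥ l), swap, dotProduct_comm (Pᵀ *ᵥ c), swap] at e4
  rw [dotProduct_comm v d]
  linarith

/-- Energy conservation for the index-1 GGL differential-algebraic equations of
a constrained mechanical system. -/
theorem ggl_energy_conservation {n m : ℕ}
    (M : Matrix (Fin n) (Fin n) ℝ) (hMs : Mᵀ = M) (hMi : IsUnit M.det)
    (V : (Fin n → ℝ) → ℝ) (hV : ContDiff ℝ 1 V)
    (g : (Fin n → ℝ) → (Fin m → ℝ)) (hg : ContDiff ℝ 2 g)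
    (q v : ℝ → Fin n → ℝ) (hq : Differentiable ℝ q) (hv : Differentiable ℝ v)
    (lam gam : ℝ → Fin m → ℝ)
    (h1 : ∀ t, deriv q t = v t + M⁻¹ *ᵥ ((jaco g (q t))ᵀ *ᵥ gam t))
    (h2 : ∀ t, M *ᵥ deriv v t =
        -grad V (q t) - (jaco g (q t))ᵀ *ᵥ lam t - (Pmat g (q t) (v t))ᵀ *ᵥ gam t)
    (h3 : ∀ t, (0 : Fin m → ℝ) =
        jaco g (q t) *ᵥ v t + (jaco g (q t) * M⁻¹ * (jaco g (q t))ᵀ) *ᵥ gam t)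
    (h4 : ∀ t, (0 : Fin m → ℝ) =
        -((jaco g (q t) * M⁻¹) *ᵥ grad V (q t)) + Pmat g (q t) (v t) *ᵥ v t
          - (jaco g (q t) * M⁻¹ * (jaco g (q t))ᵀ) *ᵥ lam t
          + (Pmat g (q t) (v t) * M⁻¹ * (jaco g (q t))ᵀ
              - jaco g (q t) * M⁻¹ * (Pmat g (q t) (v t))ᵀ) *ᵥ gam t) :
    ∀ s t : ℝ,
      (1 / 2) * (v s ⬝ᵥ (M *ᵥ v s)) + V (q s)
        = (1 / 2) * (v t ⬝ᵥ (M *ᵥ v t)) + V (q t) := by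
  have hA : (M⁻¹)ᵀ = M⁻¹ := by rw [transpose_nonsing_inv, hMs]
  have hH : ∀ t, HasDerivAt (fun s => (1 / 2) * (v s ⬝ᵥ (M *ᵥ v s)) + V (q s)) 0 t := by
    intro t
    have hVq := ((hV.differentiable one_ne_zero) (q t)).hasFDerivAt.comp_hasDerivAt t
      (hq t).hasDerivAt
    refine ((hasDerivAt_half_quadratic hMs (hv t).hasDerivAt).add hVq).congr_deriv ?_
    rw [fderiv_apply_eq_grad_dotProduct, h1, h2]
    exact ggl_power_eq_zero hA _ _ _ _ _ _ (h3 t) (h4 t)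
  exact is_const_of_deriv_eq_zero (fun t => (hH t).differentiableAt) fun t => (hH t).deriv

end
end

section
/- Let g : ℝⁿ → ℝᵐ have components g_a(q) = (1/2)⟨q, A_a q⟩ + ⟨b_a, q⟩ + c_a with each A_a symmetric, let G(q) := Dg(q), g_v(q,v) := G(q)v, P(q,v) := ∂_q g_v(q,v), let M be a symmetric invertible n×n matrix, and let V : ℝⁿ → ℝ be continuously differentiable. Fix h > 0 and suppose q⁰, q¹, v⁰, v¹ ∈ ℝⁿ and λ_m, γ_m ∈ ℝᵐ satisfy the midpoint step of the GGL index-1 system: q¹ − q⁰ = h(v_m + M⁻¹G(q_m)ᵀγ_m); M(v¹ − v⁰) = h(−∇V(q_m) − G(q_m)ᵀλ_m − P(q_m,v_m)ᵀγ_m); 0 = G(q_m)v_m + G(q_m)M⁻¹G(q_m)ᵀγ_m; and 0 = −G(q_m)M⁻¹∇V(q_m) + P(q_m,v_m)v_m − G(q_m)M⁻¹G(q_m)ᵀλ_m + (P(q_m,v_m)M⁻¹G(q_m)ᵀ − G(q_m)M⁻¹P(q_m,v_m)ᵀ)γ_m, where q_m := (q⁰+q¹)/2, v_m := (v⁰+v¹)/2.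 Then both constraint levels are preserved: g(q¹) = g(q⁰) and G(q¹)v¹ = G(q⁰)v⁰. In particular, consistent initial data with g(q⁰) = 0 and G(q⁰)v⁰ = 0 remain on both constraint levels for all steps. -/
open Matrix

noncomputable section

/-- One implicit-midpoint step of the GGL index-1 system for `g`, `M`, `V`. -/
def GGLStep {n m : ℕ} (g : (Fin n → ℝ) → (Fin m → ℝ))
    (M : Matrix (Fin n) (Fin n) ℝ) (V : (Fin n → ℝ) → ℝ) (h : ℝ)
    (q0 q1 v0 v1 : Fin n → ℝ) (lamm gamm : Fin m → ℝ) : Prop :=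
  q1 - q0 = h • (((1 : ℝ) / 2) • (v0 + v1)
      + M⁻¹ *ᵥ ((jaco g (((1 : ℝ) / 2) • (q0 + q1)))ᵀ *ᵥ gamm)) ∧
  M *ᵥ (v1 - v0) = h • (-grad V (((1 : ℝ) / 2) • (q0 + q1))
      - (jaco g (((1 : ℝ) / 2) • (q0 + q1)))ᵀ *ᵥ lamm
      - (Pmat g (((1 : ℝ) / 2) • (q0 + q1)) (((1 : ℝ) / 2) • (v0 + v1)))ᵀ *ᵥ gamm) ∧
  (0 : Fin m → ℝ) =
      jaco g (((1 : ℝ) / 2) • (q0 + q1)) *ᵥ (((1 : ℝ) / 2) • (v0 + v1))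
      + (jaco g (((1 : ℝ) / 2) • (q0 + q1)) * M⁻¹
          * (jaco g (((1 : ℝ) / 2) • (q0 + q1)))ᵀ) *ᵥ gamm ∧
  (0 : Fin m → ℝ) =
      -((jaco g (((1 : ℝ) / 2) • (q0 + q1)) * M⁻¹) *ᵥ grad V (((1 : ℝ) / 2) • (q0 + q1)))
      + Pmat g (((1 : ℝ) / 2) • (q0 + q1)) (((1 : ℝ) / 2) • (v0 + v1))
          *ᵥ (((1 : ℝ) / 2) • (v0 + v1))
      - (jaco g (((1 : ℝ) / 2) • (q0 + q1)) * M⁻¹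
          * (jaco g (((1 : ℝ) / 2) • (q0 + q1)))ᵀ) *ᵥ lamm
      + (Pmat g (((1 : ℝ) / 2) • (q0 + q1)) (((1 : ℝ) / 2) • (v0 + v1)) * M⁻¹
            * (jaco g (((1 : ℝ) / 2) • (q0 + q1)))ᵀ
          - jaco g (((1 : ℝ) / 2) • (q0 + q1)) * M⁻¹
            * (Pmat g (((1 : ℝ) / 2) • (q0 + q1)) (((1 : ℝ) / 2) • (v0 + v1)))ᵀ) *ᵥ gamm

theorem quadratic_hasFDerivAt {n m : ℕ}
    (A : Fin m → Matrix (Fin n) (Fin n) ℝ) (hA : ∀ a, (A a)ᵀ = A a)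
    (b : Fin m → Fin n → ℝ) (c : Fin m → ℝ) (q : Fin n → ℝ) :
    HasFDerivAt (fun q a => (1 / 2) * (q ⬝ᵥ (A a *ᵥ q)) + b a ⬝ᵥ q + c a)
      (LinearMap.toContinuousLinearMap
        (Matrix.mulVecLin (Matrix.of fun a => A a *ᵥ q + b a))) q := by
  rw [hasFDerivAt_pi']
  intro a
  have hid (i : Fin n) : HasFDerivAt (fun x : Fin n → ℝ => x i)
      (ContinuousLinearMap.proj (R := ℝ) (φ := fun _ : Fin n => ℝ) i) q :=
    hasFDerivAt_apply i q
  have hmul (i : Fin n) := HasFDerivAt.fun_sum (u := Finset.univ)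
    fun j _ => (hid j).const_mul (A a i j)
  have hquad := HasFDerivAt.fun_sum (u := Finset.univ) fun i _ => (hid i).mul (hmul i)
  have hlin := HasFDerivAt.fun_sum (u := Finset.univ) fun i _ => (hid i).const_mul (b a i)
  refine (((hquad.const_mul (1 / 2)).add hlin).add_const (c a)).congr_fderiv ?_
  ext1 x
  have hsymm : q ⬝ᵥ (A a *ᵥ x) = (A a *ᵥ q) ⬝ᵥ x := by
    rw [dotProduct_mulVec, ← mulVec_transpose, hA]
  have key : (1 / 2 : ℝ) * (q ⬝ᵥ (A a *ᵥ x) + (A a *ᵥ q) ⬝ᵥ x) + b a ⬝ᵥ x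
      = (A a *ᵥ q + b a) ⬝ᵥ x := by
    rw [hsymm, add_dotProduct]; ring
  simpa [dotProduct, mulVec, Finset.sum_add_distrib, mul_add] using key

theorem jaco_quadratic {n m : ℕ}
    (A : Fin m → Matrix (Fin n) (Fin n) ℝ) (hA : ∀ a, (A a)ᵀ = A a)
    (b : Fin m → Fin n → ℝ) (c : Fin m → ℝ) (q : Fin n → ℝ) :
    jaco (fun q a => (1 / 2) * (q ⬝ᵥ (A a *ᵥ q)) + b a ⬝ᵥ q + c a) q
      = Matrix.of fun a => A a *ᵥ q + b a := by
  ext a i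
  simp only [jaco, (quadratic_hasFDerivAt A hA b c q).fderiv]
  simp

theorem Pmat_quadratic {n m : ℕ}
    (A : Fin m → Matrix (Fin n) (Fin n) ℝ) (hA : ∀ a, (A a)ᵀ = A a)
    (b : Fin m → Fin n → ℝ) (c : Fin m → ℝ) (q v : Fin n → ℝ) :
    Pmat (fun q a => (1 / 2) * (q ⬝ᵥ (A a *ᵥ q)) + b a ⬝ᵥ q + c a) q v
      = Matrix.of fun a => A a *ᵥ v := by
  ext a i
  have hfun : (fun q' : Fin n → ℝ => ((Matrix.of fun a => A a *ᵥ q' + b a) *ᵥ v) a)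
      = fun q' => LinearMap.toContinuousLinearMap
          (dotProductBilin ℝ ℝ (A a *ᵥ v)) q' + b a ⬝ᵥ v := by
    funext q'
    change (A a *ᵥ q' + b a) ⬝ᵥ v = (A a *ᵥ v) ⬝ᵥ q' + b a ⬝ᵥ v
    rw [add_dotProduct, dotProduct_comm (A a *ᵥ q'), dotProduct_mulVec, ← mulVec_transpose, hA]
  simp only [Pmat, jaco_quadratic A hA b c, of_apply, hfun]
  rw [fderiv_add_const, ContinuousLinearMap.fderiv]
  change (A a *ᵥ v) ⬝ᵥ Pi.single i 1 = _
  simp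

theorem GGLStep.constraints_eq {n m : ℕ}
    {A : Fin m → Matrix (Fin n) (Fin n) ℝ} (hA : ∀ a, (A a)ᵀ = A a)
    {b : Fin m → Fin n → ℝ} {c : Fin m → ℝ}
    {g : (Fin n → ℝ) → (Fin m → ℝ)}
    (hg : g = fun q a => (1 / 2) * (q ⬝ᵥ (A a *ᵥ q)) + b a ⬝ᵥ q + c a)
    {M : Matrix (Fin n) (Fin n) ℝ} (hMi : IsUnit M.det)
    {V : (Fin n → ℝ) → ℝ} {h : ℝ} {q0 q1 v0 v1 : Fin n → ℝ} {lamm gamm : Fin m → ℝ}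
    (hstep : GGLStep g M V h q0 q1 v0 v1 lamm gamm) :
    g q1 = g q0 ∧ jaco g q1 *ᵥ v1 = jaco g q0 *ᵥ v0 := by
  have hsymm (a : Fin m) (x y : Fin n → ℝ) : (A a *ᵥ x) ⬝ᵥ y = (A a *ᵥ y) ⬝ᵥ x := by
    rw [dotProduct_comm, dotProduct_mulVec, ← mulVec_transpose, hA]
  have hJ (q : Fin n → ℝ) : jaco g q = Matrix.of fun a => A a *ᵥ q + b a := by
    rw [hg, jaco_quadratic A hA b c]
  have hP (q v : Fin n → ℝ) : Pmat g q v = Matrix.of fun a => A a *ᵥ v := by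
    rw [hg, Pmat_quadratic A hA b c]
  have hpos : g q1 - g q0 = jaco g (((1 : ℝ) / 2) • (q0 + q1)) *ᵥ (q1 - q0) := by
    funext a
    rw [hJ, hg]
    change _ - _ = (A a *ᵥ _ + b a) ⬝ᵥ (q1 - q0)
    simp only [mulVec_smul, mulVec_add, add_dotProduct, smul_dotProduct, dotProduct_sub,
      smul_eq_mul, dotProduct_comm _ (A a *ᵥ _), hsymm a q1 q0]
    ring
  have hvel : jaco g q1 *ᵥ v1 - jaco g q0 *ᵥ v0
      = jaco g (((1 : ℝ) / 2) • (q0 + q1)) *ᵥ (v1 - v0)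
        + Pmat g (((1 : ℝ) / 2) • (q0 + q1)) (((1 : ℝ) / 2) • (v0 + v1)) *ᵥ (q1 - q0) := by
    funext a
    rw [hJ, hJ, hJ, hP]
    change (A a *ᵥ q1 + b a) ⬝ᵥ v1 - (A a *ᵥ q0 + b a) ⬝ᵥ v0
      = (A a *ᵥ _ + b a) ⬝ᵥ (v1 - v0) + (A a *ᵥ _) ⬝ᵥ (q1 - q0)
    simp only [mulVec_smul, mulVec_add, add_dotProduct, smul_dotProduct, dotProduct_sub,
      smul_eq_mul, hsymm a v0, hsymm a v1]
    ring
  obtain ⟨hq, hv, hG, hGdot⟩ := hstep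
  have hv' := congrArg (M⁻¹ *ᵥ ·) hv
  simp only [mulVec_mulVec, nonsing_inv_mul M hMi, one_mulVec] at hv'
  constructor
  · rw [← sub_eq_zero, hpos, hq, mulVec_smul, mulVec_add, mulVec_mulVec, mulVec_mulVec,
      ← hG, smul_zero]
  · rw [← sub_eq_zero, hvel, hq, hv', ← smul_zero (A := Fin m → ℝ) h, hGdot]
    simp only [mulVec_smul, mulVec_add, mulVec_sub, mulVec_neg, sub_mulVec, mulVec_mulVec,
      Matrix.mul_assoc, ← smul_add]
    congr 1
    abel

/-- The implicit midpoint discretization of the GGL index-1 system preserves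
both the position-level and the velocity-level constraints exactly, for at
most quadratic constraint functions; consistent initial data stay on both
constraint levels for all steps. -/
theorem ggl_midpoint_constraint_preservation {n m : ℕ}
    (A : Fin m → Matrix (Fin n) (Fin n) ℝ) (hA : ∀ a, (A a)ᵀ = A a)
    (b : Fin m → Fin n → ℝ) (c : Fin m → ℝ)
    (g : (Fin n → ℝ) → (Fin m → ℝ))
    (hg : g = fun q a => (1 / 2) * (q ⬝ᵥ (A a *ᵥ q)) + b a ⬝ᵥ q + c a)
    (M : Matrix (Fin n) (Fin n) ℝ) (hMs : Mᵀ = M) (hMi : IsUnit M.det)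
    (V : (Fin n → ℝ) → ℝ) (hV : ContDiff ℝ 1 V)
    (h : ℝ) (hh : 0 < h) :
    (∀ (q0 q1 v0 v1 : Fin n → ℝ) (lamm gamm : Fin m → ℝ),
      GGLStep g M V h q0 q1 v0 v1 lamm gamm →
      g q1 = g q0 ∧ jaco g q1 *ᵥ v1 = jaco g q0 *ᵥ v0) ∧
    (∀ (q v : ℕ → Fin n → ℝ) (lamm gamm : ℕ → Fin m → ℝ),
      (∀ N, GGLStep g M V h (q N) (q (N + 1)) (v N) (v (N + 1)) (lamm N) (gamm N)) →
      g (q 0) = 0 → jaco g (q 0) *ᵥ v 0 = 0 →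
      ∀ N, g (q N) = 0 ∧ jaco g (q N) *ᵥ v N = 0) := by
  have step {q0 q1 v0 v1 : Fin n → ℝ} {lamm gamm : Fin m → ℝ}
      (hs : GGLStep g M V h q0 q1 v0 v1 lamm gamm) := hs.constraints_eq hA hg hMi
  refine ⟨fun _ _ _ _ _ _ hs => step hs, fun q v lamm gamm hs hg0 hv0 N => ?_⟩
  induction N with
  | zero => exact ⟨hg0, hv0⟩
  | succ N ih =>
    rw [(step (hs N)).1, (step (hs N)).2]
    exact ih

end
end

section
/- For all vectors d₁, d₂, d₃ ∈ ℝ³ and all λ = (λ₁,…,λ₆) ∈ ℝ⁶, the total torque of the internal constraint forces of the director formulation vanishes: d₁ × (λ₁d₁ + λ₄d₂ + λ₅d₃) + d₂ × (λ₄d₁ + λ₂d₂ + λ₆d₃) + d₃ × (λ₅d₁ + λ₆d₂ + λ₃d₃) = 0, where × denotes the cross product in ℝ³. -/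
noncomputable section

/-- The total torque of the internal constraint forces of the director
formulation vanishes. -/
theorem director_constraint_torque_free (d1 d2 d3 : Fin 3 → ℝ) (lam : Fin 6 → ℝ) :
    crossProduct d1 (lam 0 • d1 + lam 3 • d2 + lam 4 • d3)
      + crossProduct d2 (lam 3 • d1 + lam 1 • d2 + lam 5 • d3)
      + crossProduct d3 (lam 4 • d1 + lam 5 • d2 + lam 2 • d3) = 0 := by
  simp only [map_add, map_smul, cross_self]
  rw [← cross_anticomm d1 d2, ← cross_anticomm d1 d3, ← cross_anticomm d2 d3]
  module

end
end

section
/- Let m, E₁, E₂, E₃ > 0, V : ℝ³ → ℝ continuously differentiable, and let φ, d₁, d₂, d₃, v_φ, v_{d₁}, v_{d₂}, v_{d₃} : ℝ → ℝ³ be differentiable curves and λ : ℝ → ℝ⁶, f_φ, f₁, f₂, f₃ : ℝ → ℝ³ functions satisfying, for all t: φ̇ = v_φ; ḋᵢ = v_{dᵢ} for i = 1,2,3; m v̇_φ = −∇V(φ) + f_φ; E₁ v̇_{d₁} = −(λ₁d₁ + λ₄d₂ + λ₅d₃) + f₁; E₂ v̇_{d₂} = −(λ₄d₁ + λ₂d₂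 + λ₆d₃) + f₂; E₃ v̇_{d₃} = −(λ₅d₁ + λ₆d₂ + λ₃d₃) + f₃. Then the total angular momentum L := φ × m v_φ + Σᵢ dᵢ × Eᵢ v_{dᵢ} satisfies the balance law (d/dt) L = −φ × ∇V(φ) + φ × f_φ + Σᵢ dᵢ × fᵢ for all t. -/
open Matrix

noncomputable section

theorem HasDerivAt.crossProduct {u v : ℝ → Fin 3 → ℝ} {u' v' : Fin 3 → ℝ} {t : ℝ}
    (hu : HasDerivAt u u' t) (hv : HasDerivAt v v' t) :
    HasDerivAt (fun s => u s ⨯₃ v s) (u' ⨯₃ v t + u t ⨯₃ v') t := by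
  have hu := hasDerivAt_pi.1 hu
  have hv := hasDerivAt_pi.1 hv
  have h (j k : Fin 3) : HasDerivAt (fun s => u s j * v s k - u s k * v s j)
      (u' j * v t k - u' k * v t j + (u t j * v' k - u t k * v' j)) t :=
    (((hu j).mul (hv k)).sub ((hu k).mul (hv j))).congr_deriv (by ring)
  refine hasDerivAt_pi.2 fun i => ?_
  fin_cases i
  · exact h 1 2
  · exact h 2 0
  · exact h 0 1

/-- The moment of a linear momentum `c • v`, with `v` the velocity of `u`, changes at the rate
given by the torque of the force `c • v'`. -/
theorem hasDerivAt_crossProduct_smul_velocity {u v : ℝ → Fin 3 → ℝ} (c : ℝ) {F : Fin 3 → ℝ}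
    {t : ℝ} (hu : DifferentiableAt ℝ u t) (hv : DifferentiableAt ℝ v t)
    (huv : deriv u t = v t) (hF : c • deriv v t = F) :
    HasDerivAt (fun s => u s ⨯₃ (c • v s)) (u t ⨯₃ F) t := by
  have h := hu.hasDerivAt.crossProduct (hv.hasDerivAt.const_smul c)
  rw [hF, huv] at h
  simpa using h

/-- Balance of total angular momentum for the director formulation of rigid
body dynamics. -/
theorem director_angular_momentum_balance
    (m E1 E2 E3 : ℝ) (hm : 0 < m) (hE1 : 0 < E1) (hE2 : 0 < E2) (hE3 : 0 < E3)
    (V : (Fin 3 → ℝ) → ℝ) (hV : ContDiff ℝ 1 V)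
    (φ d1 d2 d3 vφ vd1 vd2 vd3 : ℝ → Fin 3 → ℝ)
    (hφ : Differentiable ℝ φ)
    (hd1 : Differentiable ℝ d1) (hd2 : Differentiable ℝ d2) (hd3 : Differentiable ℝ d3)
    (hvφ : Differentiable ℝ vφ)
    (hvd1 : Differentiable ℝ vd1) (hvd2 : Differentiable ℝ vd2) (hvd3 : Differentiable ℝ vd3)
    (lam : ℝ → Fin 6 → ℝ) (fφ f1 f2 f3 : ℝ → Fin 3 → ℝ)
    (h1 : ∀ t, deriv φ t = vφ t)
    (h2 : ∀ t, deriv d1 t = vd1 t)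
    (h3 : ∀ t, deriv d2 t = vd2 t)
    (h4 : ∀ t, deriv d3 t = vd3 t)
    (h5 : ∀ t, m • deriv vφ t = -grad V (φ t) + fφ t)
    (h6 : ∀ t, E1 • deriv vd1 t =
        -(lam t 0 • d1 t + lam t 3 • d2 t + lam t 4 • d3 t) + f1 t)
    (h7 : ∀ t, E2 • deriv vd2 t =
        -(lam t 3 • d1 t + lam t 1 • d2 t + lam t 5 • d3 t) + f2 t)
    (h8 : ∀ t, E3 • deriv vd3 t =
        -(lam t 4 • d1 t + lam t 5 • d2 t + lam t 2 • d3 t) + f3 t) :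
    ∀ t, deriv (fun s =>
        crossProduct (φ s) (m • vφ s) + crossProduct (d1 s) (E1 • vd1 s)
          + crossProduct (d2 s) (E2 • vd2 s) + crossProduct (d3 s) (E3 • vd3 s)) t
      = -crossProduct (φ t) (grad V (φ t)) + crossProduct (φ t) (fφ t)
        + crossProduct (d1 t) (f1 t) + crossProduct (d2 t) (f2 t)
        + crossProduct (d3 t) (f3 t) := by
  intro t
  have hL :=
    (((hasDerivAt_crossProduct_smul_velocity m (hφ t) (hvφ t) (h1 t) (h5 t)).add
      (hasDerivAt_crossProduct_smul_velocity E1 (hd1 t) (hvd1 t) (h2 t) (h6 t))).add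
      (hasDerivAt_crossProduct_smul_velocity E2 (hd2 t) (hvd2 t) (h3 t) (h7 t))).add
      (hasDerivAt_crossProduct_smul_velocity E3 (hd3 t) (hvd3 t) (h4 t) (h8 t))
  refine hL.deriv.trans ?_
  simp only [map_add, map_neg, map_smul, cross_self]
  rw [← cross_anticomm (d1 t) (d2 t), ← cross_anticomm (d1 t) (d3 t),
    ← cross_anticomm (d2 t) (d3 t)]
  module

end
end

section
/- Let m, E₁, E₂, E₃ > 0, V : ℝ³ → ℝ continuously differentiable, h > 0, and suppose vectors φ⁰, φ¹, dᵢ⁰, dᵢ¹, v_φ⁰, v_φ¹, v_{dᵢ}⁰, v_{dᵢ}¹ ∈ ℝ³ (i = 1,2,3), multipliers λ ∈ ℝ⁶, and forces f_φ, f₁, f₂, f₃ ∈ ℝ³ satisfy the implicit midpoint scheme: φ¹ − φ⁰ = h v_φ^m; dᵢ¹ − dᵢ⁰ = h v_{dᵢ}^m; m(v_φ¹ − v_φ⁰) = −h ∇V(φ^m) + h f_φ; E₁(v_{d₁}¹ − v_{d₁}⁰) = −h(λ₁d₁^m + λ₄d₂^m + λ₅d₃^m) + h f₁; E₂(v_{d₂}¹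 − v_{d₂}⁰) = −h(λ₄d₁^m + λ₂d₂^m + λ₆d₃^m) + h f₂; E₃(v_{d₃}¹ − v_{d₃}⁰) = −h(λ₅d₁^m + λ₆d₂^m + λ₃d₃^m) + h f₃, where superscript m denotes the midpoint (e.g. φ^m := (φ⁰+φ¹)/2). Then the discrete angular momentum Lⁿ := φⁿ × m v_φⁿ + Σᵢ dᵢⁿ × Eᵢ v_{dᵢ}ⁿ (n = 0,1) satisfies the discrete balance law L¹ − L⁰ = −h [ φ^m × ∇V(φ^m) − φ^m × f_φ − Σᵢ dᵢ^m × fᵢ ]. In particular, if f_φ = fᵢ = 0 and ∇V ≡ 0 then L¹ = L⁰. -/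
open Matrix

noncomputable section

/-- Under the midpoint rule `a₁ - a₀ = h vᵐ`, the moment of momentum `a × c v` changes by the moment
at the midpoint of the momentum increment. -/
theorem cross_smul_sub_cross_smul_of_midpoint {a₀ a₁ v₀ v₁ a v : Fin 3 → ℝ} {h : ℝ} (c : ℝ)
    (ha : a = ((1 : ℝ) / 2) • (a₀ + a₁)) (hv : v = ((1 : ℝ) / 2) • (v₀ + v₁))
    (hstep : a₁ - a₀ = h • v) :
    crossProduct a₁ (c • v₁) - crossProduct a₀ (c • v₀) = crossProduct a (c • (v₁ - v₀)) := by
  have hzero : crossProduct (a₁ - a₀) v = 0 := by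
    rw [hstep, map_smul, LinearMap.smul_apply, cross_self, smul_zero]
  have hsplit : crossProduct a₁ (c • v₁) - crossProduct a₀ (c • v₀)
      = crossProduct a (c • (v₁ - v₀)) + c • crossProduct (a₁ - a₀) v := by
    subst ha hv
    simp only [map_add, map_sub, map_smul, LinearMap.add_apply, LinearMap.sub_apply,
      LinearMap.smul_apply]
    module
  rw [hsplit, hzero, smul_zero, add_zero]

/-- Discrete balance of angular momentum for the implicit midpoint
discretization of the director formulation of rigid body dynamics. -/
theorem director_discrete_angular_momentum_balance
    (m E1 E2 E3 : ℝ) (hm : 0 < m) (hE1 : 0 < E1) (hE2 : 0 < E2) (hE3 : 0 < E3)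
    (V : (Fin 3 → ℝ) → ℝ) (hV : ContDiff ℝ 1 V)
    (h : ℝ) (hh : 0 < h)
    (φ0 φ1 d10 d11 d20 d21 d30 d31 : Fin 3 → ℝ)
    (vφ0 vφ1 vd10 vd11 vd20 vd21 vd30 vd31 : Fin 3 → ℝ)
    (lam : Fin 6 → ℝ) (fφ f1 f2 f3 : Fin 3 → ℝ)
    (φm d1m d2m d3m vφm vd1m vd2m vd3m : Fin 3 → ℝ)
    (hφm : φm = ((1 : ℝ) / 2) • (φ0 + φ1))
    (hd1m : d1m = ((1 : ℝ) / 2) • (d10 + d11))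
    (hd2m : d2m = ((1 : ℝ) / 2) • (d20 + d21))
    (hd3m : d3m = ((1 : ℝ) / 2) • (d30 + d31))
    (hvφm : vφm = ((1 : ℝ) / 2) • (vφ0 + vφ1))
    (hvd1m : vd1m = ((1 : ℝ) / 2) • (vd10 + vd11))
    (hvd2m : vd2m = ((1 : ℝ) / 2) • (vd20 + vd21))
    (hvd3m : vd3m = ((1 : ℝ) / 2) • (vd30 + vd31))
    (h1 : φ1 - φ0 = h • vφm)
    (h2 : d11 - d10 = h • vd1m)
    (h3 : d21 - d20 = h • vd2m)
    (h4 : d31 - d30 = h • vd3m)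
    (h5 : m • (vφ1 - vφ0) = -(h • grad V φm) + h • fφ)
    (h6 : E1 • (vd11 - vd10) = -(h • (lam 0 • d1m + lam 3 • d2m + lam 4 • d3m)) + h • f1)
    (h7 : E2 • (vd21 - vd20) = -(h • (lam 3 • d1m + lam 1 • d2m + lam 5 • d3m)) + h • f2)
    (h8 : E3 • (vd31 - vd30) = -(h • (lam 4 • d1m + lam 5 • d2m + lam 2 • d3m)) + h • f3)
    (L0 L1 : Fin 3 → ℝ)
    (hL0 : L0 = crossProduct φ0 (m • vφ0) + crossProduct d10 (E1 • vd10)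
        + crossProduct d20 (E2 • vd20) + crossProduct d30 (E3 • vd30))
    (hL1 : L1 = crossProduct φ1 (m • vφ1) + crossProduct d11 (E1 • vd11)
        + crossProduct d21 (E2 • vd21) + crossProduct d31 (E3 • vd31)) :
    L1 - L0 = -(h • (crossProduct φm (grad V φm) - crossProduct φm fφ
        - (crossProduct d1m f1 + crossProduct d2m f2 + crossProduct d3m f3))) ∧
    (fφ = 0 → f1 = 0 → f2 = 0 → f3 = 0 → (∀ x, grad V x = 0) → L1 = L0) := by
  have balance : L1 - L0 = -(h • (crossProduct φm (grad V φm) - crossProduct φm fφ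
      - (crossProduct d1m f1 + crossProduct d2m f2 + crossProduct d3m f3))) := by
    have increment : L1 - L0 = crossProduct φm (m • (vφ1 - vφ0))
        + crossProduct d1m (E1 • (vd11 - vd10)) + crossProduct d2m (E2 • (vd21 - vd20))
        + crossProduct d3m (E3 • (vd31 - vd30)) := by
      rw [hL0, hL1, ← cross_smul_sub_cross_smul_of_midpoint m hφm hvφm h1,
        ← cross_smul_sub_cross_smul_of_midpoint E1 hd1m hvd1m h2,
        ← cross_smul_sub_cross_smul_of_midpoint E2 hd2m hvd2m h3,
        ← cross_smul_sub_cross_smul_of_midpoint E3 hd3m hvd3m h4]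
      abel
    rw [increment, h5, h6, h7, h8]
    simp only [map_add, map_neg, map_smul, cross_self]
    rw [← cross_anticomm d1m d2m, ← cross_anticomm d1m d3m, ← cross_anticomm d2m d3m]
    module
  refine ⟨balance, fun hfφ hf1 hf2 hf3 hgrad => sub_eq_zero.mp ?_⟩
  simp [balance, hfφ, hf1, hf2, hf3, hgrad]

end
end

section
/- Let L : ℝⁿ × ℝⁿ → ℝ be twice continuously differentiable, B̃ : ℝⁿ × ℝⁿ → Matrix (Fin n) (Fin p) ℝ, let q, v : ℝ → ℝⁿ be differentiable curves and u : ℝ → ℝᵖ a function, and assume the Hessian ∂²_{vv}L(q(t), v(t)) is invertible for every t. Then (q,v) satisfies the unconstrained Euler–Lagrange equations — q̇ = v and (d/dt)[∂_v L(q,v)] = ∂_q L(q,v) + B̃(q,v)u — at every t if and only if at every t it satisfies the skew-gradient system: (∂²_{vq}L(q,v) − (∂²_{vq}L(q,v))ᵀ) q̇ + ∂²_{vv}L(q,v) v̇ = ∂_q L(q,v) − ∂²_{qv}L(q,v) v + B̃(q,v)u, and −∂²_{vv}L(q,v) q̇ = −∂²_{vv}L(q,v) v. -/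
open Matrix

noncomputable section

/-- Gradient of `L` with respect to its first argument. -/
def dqL {n : ℕ} (L : (Fin n → ℝ) → (Fin n → ℝ) → ℝ) (q v : Fin n → ℝ) : Fin n → ℝ :=
  grad (fun q' => L q' v) q

/-- Gradient of `L` with respect to its second argument. -/
def dvL {n : ℕ} (L : (Fin n → ℝ) → (Fin n → ℝ) → ℝ) (q v : Fin n → ℝ) : Fin n → ℝ :=
  grad (fun v' => L q v') v

/-- Mixed second partial derivatives: entry `(i,j)` is `∂²L/∂qᵢ∂vⱼ`. -/
def d2qvL {n : ℕ} (L : (Fin n → ℝ) → (Fin n → ℝ) → ℝ) (q v : Fin n → ℝ) :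
    Matrix (Fin n) (Fin n) ℝ :=
  Matrix.of fun i j => fderiv ℝ (fun v' => dqL L q v' i) v (Pi.single j 1)

/-- Mixed second partial derivatives `∂²_{vq}L = (∂²_{qv}L)ᵀ`. -/
def d2vqL {n : ℕ} (L : (Fin n → ℝ) → (Fin n → ℝ) → ℝ) (q v : Fin n → ℝ) :
    Matrix (Fin n) (Fin n) ℝ :=
  (d2qvL L q v)ᵀ

/-- Hessian of `L` with respect to its second argument. -/
def d2vvL {n : ℕ} (L : (Fin n → ℝ) → (Fin n → ℝ) → ℝ) (q v : Fin n → ℝ) :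
    Matrix (Fin n) (Fin n) ℝ :=
  Matrix.of fun i j => fderiv ℝ (fun v' => dvL L q v' i) v (Pi.single j 1)

theorem hasFDerivAt_curry_fst {E F G : Type*} [NormedAddCommGroup E] [NormedSpace ℝ E]
    [NormedAddCommGroup F] [NormedSpace ℝ F] [NormedAddCommGroup G] [NormedSpace ℝ G]
    {f : E × F → G} {x : E} {y : F} (hf : DifferentiableAt ℝ f (x, y)) :
    HasFDerivAt (fun x' => f (x', y))
      ((fderiv ℝ f (x, y)).comp (ContinuousLinearMap.inl ℝ E F)) x :=
  hf.hasFDerivAt.comp x (hasFDerivAt_prodMk_left x y)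

theorem hasFDerivAt_curry_snd {E F G : Type*} [NormedAddCommGroup E] [NormedSpace ℝ E]
    [NormedAddCommGroup F] [NormedSpace ℝ F] [NormedAddCommGroup G] [NormedSpace ℝ G]
    {f : E × F → G} {x : E} {y : F} (hf : DifferentiableAt ℝ f (x, y)) :
    HasFDerivAt (fun y' => f (x, y'))
      ((fderiv ℝ f (x, y)).comp (ContinuousLinearMap.inr ℝ E F)) y :=
  hf.hasFDerivAt.comp y (hasFDerivAt_prodMk_right x y)

section SecondDerivatives

variable {n : ℕ} {L : (Fin n → ℝ) → (Fin n → ℝ) → ℝ}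

theorem dqL_apply (hL : Differentiable ℝ (Function.uncurry L)) (q v : Fin n → ℝ) (i : Fin n) :
    dqL L q v i = fderiv ℝ (Function.uncurry L) (q, v) (Pi.single i 1, 0) := by
  have h := (hasFDerivAt_curry_fst (hL (q, v))).fderiv
  simp only [Function.uncurry_apply_pair] at h
  simp [dqL, grad, h]

theorem dvL_apply (hL : Differentiable ℝ (Function.uncurry L)) (q v : Fin n → ℝ) (i : Fin n) :
    dvL L q v i = fderiv ℝ (Function.uncurry L) (q, v) (0, Pi.single i 1) := by
  have h := (hasFDerivAt_curry_snd (hL (q, v))).fderiv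
  simp only [Function.uncurry_apply_pair] at h
  simp [dvL, grad, h]

theorem ContDiff.differentiable_fderiv_of_two {E G : Type*} [NormedAddCommGroup E]
    [NormedSpace ℝ E] [NormedAddCommGroup G] [NormedSpace ℝ G] {f : E → G}
    (hf : ContDiff ℝ 2 f) : Differentiable ℝ (fderiv ℝ f) :=
  (hf.fderiv_right (m := 1) (by norm_num)).differentiable one_ne_zero

theorem d2qvL_apply (hL : ContDiff ℝ 2 (Function.uncurry L)) (q v : Fin n → ℝ) (i j : Fin n) :
    d2qvL L q v i j = fderiv ℝ (fderiv ℝ (Function.uncurry L)) (q, v)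
      (0, Pi.single j 1) (Pi.single i 1, 0) := by
  have h := ((hasFDerivAt_curry_snd (hL.differentiable_fderiv_of_two (q, v))).clm_apply
    (hasFDerivAt_const ((Pi.single i 1, 0) : (Fin n → ℝ) × (Fin n → ℝ)) v)).fderiv
  simp [d2qvL, dqL_apply (hL.differentiable two_ne_zero), h]

theorem d2vvL_apply (hL : ContDiff ℝ 2 (Function.uncurry L)) (q v : Fin n → ℝ) (i j : Fin n) :
    d2vvL L q v i j = fderiv ℝ (fderiv ℝ (Function.uncurry L)) (q, v)
      (0, Pi.single j 1) (0, Pi.single i 1) := by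
  have h := ((hasFDerivAt_curry_snd (hL.differentiable_fderiv_of_two (q, v))).clm_apply
    (hasFDerivAt_const ((0, Pi.single i 1) : (Fin n → ℝ) × (Fin n → ℝ)) v)).fderiv
  simp [d2vvL, dvL_apply (hL.differentiable two_ne_zero), h]

theorem d2vqL_apply (hL : ContDiff ℝ 2 (Function.uncurry L)) (q v : Fin n → ℝ) (i j : Fin n) :
    d2vqL L q v i j = fderiv ℝ (fderiv ℝ (Function.uncurry L)) (q, v)
      (Pi.single j 1, 0) (0, Pi.single i 1) := by
  rw [d2vqL, transpose_apply, d2qvL_apply hL]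
  exact (hL.contDiffAt.isSymmSndFDerivAt (by simp)).eq _ _

theorem LinearMap.apply_eq_sum_single {n : ℕ} (f : (Fin n → ℝ) →ₗ[ℝ] ℝ) (x : Fin n → ℝ) :
    f x = ∑ j, f (Pi.single j 1) * x j := by
  rw [f.pi_apply_eq_sum_univ x]
  refine Finset.sum_congr rfl fun j _ => ?_
  rw [smul_eq_mul, mul_comm]
  congr 2
  ext k
  simp [Pi.single_apply, eq_comm]

/-- The chain rule for the momentum `∂_v L` along a differentiable curve. -/
theorem hasDerivAt_dvL (hL : ContDiff ℝ 2 (Function.uncurry L)) {q v : ℝ → Fin n → ℝ}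
    {q' v' : Fin n → ℝ} {t : ℝ} (hq : HasDerivAt q q' t) (hv : HasDerivAt v v' t) :
    HasDerivAt (fun s => dvL L (q s) (v s))
      (d2vqL L (q t) (v t) *ᵥ q' + d2vvL L (q t) (v t) *ᵥ v') t := by
  refine hasDerivAt_pi.2 fun i => ?_
  simp only [dvL_apply (hL.differentiable two_ne_zero)]
  set D := fderiv ℝ (fderiv ℝ (Function.uncurry L)) (q t, v t) with hD
  have h : HasDerivAt (fun s => fderiv ℝ (Function.uncurry L) (q s, v s)) (D (q', v')) t :=
    (hL.differentiable_fderiv_of_two (q t, v t)).hasFDerivAt.comp_hasDerivAt t (hq.prodMk hv)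
  refine (h.clm_apply (hasDerivAt_const t
    ((0, Pi.single i 1) : (Fin n → ℝ) × (Fin n → ℝ)))).congr_deriv ?_
  have hfst := LinearMap.apply_eq_sum_single
    ((D.flip (0, Pi.single i 1)).comp (ContinuousLinearMap.inl ℝ _ _)).toLinearMap q'
  have hsnd := LinearMap.apply_eq_sum_single
    ((D.flip (0, Pi.single i 1)).comp (ContinuousLinearMap.inr ℝ _ _)).toLinearMap v'
  have hsplit : D (q', v') = D (q', 0) + D (0, v') := by
    rw [← map_add]; simp
  simp at hfst hsnd
  simp [← hD, hsplit, hfst, hsnd, mulVec, dotProduct, d2vqL_apply hL, d2vvL_apply hL]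

end SecondDerivatives

/-- The unconstrained Euler–Lagrange equations hold iff the skew-gradient
system (whose right-hand side is the negative energy gradient) holds. -/
theorem euler_lagrange_iff_skew_gradient {n p : ℕ}
    (L : (Fin n → ℝ) → (Fin n → ℝ) → ℝ)
    (hL : ContDiff ℝ 2 (fun pr : (Fin n → ℝ) × (Fin n → ℝ) => L pr.1 pr.2))
    (Bt : (Fin n → ℝ) → (Fin n → ℝ) → Matrix (Fin n) (Fin p) ℝ)
    (q v : ℝ → Fin n → ℝ) (hq : Differentiable ℝ q) (hv : Differentiable ℝ v)
    (u : ℝ → Fin p → ℝ)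
    (hHess : ∀ t, IsUnit (d2vvL L (q t) (v t)).det) :
    (∀ t : ℝ,
        deriv q t = v t ∧
        deriv (fun s => dvL L (q s) (v s)) t =
          dqL L (q t) (v t) + Bt (q t) (v t) *ᵥ u t)
    ↔
    (∀ t : ℝ,
        (d2vqL L (q t) (v t) - (d2vqL L (q t) (v t))ᵀ) *ᵥ deriv q t
            + d2vvL L (q t) (v t) *ᵥ deriv v t =
          dqL L (q t) (v t) - d2qvL L (q t) (v t) *ᵥ v t + Bt (q t) (v t) *ᵥ u t ∧
        -(d2vvL L (q t) (v t) *ᵥ deriv q t) = -(d2vvL L (q t) (v t) *ᵥ v t)) := by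
  have hL' : ContDiff ℝ 2 (Function.uncurry L) := hL
  refine forall_congr' fun t => ?_
  have hinj := mulVec_injective_iff_isUnit.2 ((isUnit_iff_isUnit_det _).2 (hHess t))
  rw [(hasDerivAt_dvL hL' (hq t).hasDerivAt (hv t).hasDerivAt).deriv, neg_inj, hinj.eq_iff,
    and_comm]
  refine and_congr_left fun hqv => ?_
  rw [hqv, d2vqL, transpose_transpose, sub_mulVec, sub_add_eq_add_sub, sub_add_eq_add_sub,
    sub_left_inj]

end
end
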